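/- Fix M, ε > 0 and a ≥ 16Mε⁻¹ + 8M. Let ρ_a be the uniform probability measure on [−a, a], let π be the uniform probability measure on the union [−a−M, −a+M] ∪ [a−M, a+M], and let τ = Σ_{k=0}^∞ 2^{−(k+1)} π^{(k)}, where π^{(0)} = δ₀ (the Dirac measure at 0) and π^{(k)} is the k-fold convolution of π with itself. Set η = ρ_a ∗ ρ_a ∗ τ. Then for every pair of Borel probability measures μ, ν supported in [−M, M] with ∫x dμ(x) − ∫x dν(x) ≥ εM, it holds that μ ∗ η >₁ ν ∗ η. -/

import Mathlib

open MeasureTheory ProbabilityTheory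
open scoped ENNReal

/-- `μ` first-order stochastically dominates `ν`: the CDF of `μ` lies below that of `ν`. -/
def FSD (μ ν : Measure ℝ) : Prop := ∀ t : ℝ, cdf μ t ≤ cdf ν t

/-- Strict first-order stochastic dominance: `FSD` together with distinctness. -/
def StrictFSD (μ ν : Measure ℝ) : Prop := FSD μ ν ∧ μ ≠ ν

/-- The uniform probability measure on a set `s ⊆ ℝ`. -/
noncomputable def unif (s : Set ℝ) : Measure ℝ := (volume s)⁻¹ • volume.restrict s

/-- The `k`-fold convolution power of a measure, with `π^(0)` the Dirac measure at `0`. -/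
noncomputable def convPow (π : Measure ℝ) : ℕ → Measure ℝ
  | 0 => Measure.dirac 0
  | k + 1 => (convPow π k).conv π


theorem unif_prob (s : Set ℝ) (h0 : volume s ≠ 0) (h1 : volume s ≠ ⊤) :
    IsProbabilityMeasure (unif s) := by
  constructor
  simp [unif, ENNReal.inv_mul_cancel h0 h1]

theorem convPow_prob (π : Measure ℝ) [IsProbabilityMeasure π] (k : ℕ) :
    IsProbabilityMeasure (convPow π k) := by
  induction k with
  | zero => simp only [convPow]; infer_instance
  | succ k ih => simp only [convPow]; infer_instance

theorem tau_lintegral (π : Measure ℝ) [IsProbabilityMeasure π] (f : ℝ → ℝ≥0∞)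
    (hf : Measurable f) :
    ∫⁻ x, f x ∂(Measure.sum fun k : ℕ => ((2 : ℝ≥0∞)⁻¹ ^ (k + 1)) • convPow π k)
      = 2⁻¹ * f 0 + 2⁻¹ * ∫⁻ x, ∫⁻ y, f (x + y) ∂π
        ∂(Measure.sum fun k : ℕ => ((2 : ℝ≥0∞)⁻¹ ^ (k + 1)) • convPow π k) := by
  rw [lintegral_sum_measure, lintegral_sum_measure, tsum_eq_zero_add' ENNReal.summable,
    ← ENNReal.tsum_mul_left]
  congr 1
  · simp [convPow, lintegral_dirac' _ hf]
  · congr 1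
    ext k
    rw [lintegral_smul_measure, lintegral_smul_measure, convPow, Measure.lintegral_conv hf,
      pow_succ _ (k + 1)]
    simp only [smul_eq_mul]
    ring

theorem tau_prob (π : Measure ℝ) [IsProbabilityMeasure π] :
    IsProbabilityMeasure
      (Measure.sum fun k : ℕ => ((2 : ℝ≥0∞)⁻¹ ^ (k + 1)) • convPow π k) := by
  constructor
  have := fun k => convPow_prob π k
  simp only [Measure.sum_apply _ MeasurableSet.univ, Measure.smul_apply, measure_univ,
    smul_eq_mul, mul_one]
  rw [ENNReal.tsum_geometric_add_one]
  simp [ENNReal.inv_mul_cancel]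

theorem cdf_conv (μ κ : Measure ℝ) [IsProbabilityMeasure μ] [IsProbabilityMeasure κ] (t : ℝ) :
    cdf (μ.conv κ) t = ∫ x, cdf κ (t - x) ∂μ := by
  have hm : Measurable fun x => cdf κ (t - x) :=
    (monotone_cdf κ).measurable.comp (by fun_prop)
  rw [integral_eq_lintegral_of_nonneg_ae (Filter.Eventually.of_forall fun x => cdf_nonneg _ _)
    hm.aestronglyMeasurable, cdf_eq_real, measureReal_def]
  congr 1
  rw [← lintegral_indicator_one measurableSet_Iic, Measure.lintegral_conv
    (measurable_one.indicator measurableSet_Iic)]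
  congr 1
  ext x
  rw [ofReal_cdf, ← lintegral_indicator_one measurableSet_Iic]
  congr 1
  ext y
  simp only [Set.indicator, Set.mem_Iic, le_sub_iff_add_le', Pi.one_apply]

/-- If the negative part of `g` is dominated by half the `π`-average of the positive part, then
averaging over `τ` gives a positive function. -/
theorem tau_pos (π : Measure ℝ) [IsProbabilityMeasure π] (g : ℝ → ℝ) (hg : Measurable g)
    (C : ℝ) (hC : ∀ x, |g x| ≤ C)
    (h : ∀ s, ENNReal.ofReal (-g s) ≤ 2⁻¹ * ∫⁻ w, ENNReal.ofReal (g (s - w)) ∂π) (t : ℝ) :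
    max (g t) 0 / 2 ≤ ∫ z, g (t - z)
      ∂(Measure.sum fun k : ℕ => ((2 : ℝ≥0∞)⁻¹ ^ (k + 1)) • convPow π k) := by
  have := tau_prob π
  have ht := tau_lintegral π (fun z => ENNReal.ofReal (g (t - z))) (by fun_prop)
  set τ := (Measure.sum fun k : ℕ => ((2 : ℝ≥0∞)⁻¹ ^ (k + 1)) • convPow π k) with hτ
  have hint : Integrable (fun z => g (t - z)) τ :=
    Integrable.of_bound (C := C)
      (hg.comp (measurable_const.sub measurable_id)).aestronglyMeasurable (Filter.Eventually.of_forall fun x => hC _)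
  rw [integral_eq_lintegral_pos_part_sub_lintegral_neg_part hint]
  have h1 : ∫⁻ z, ENNReal.ofReal (-g (t - z)) ∂τ ≤
      2⁻¹ * ∫⁻ x, ∫⁻ y, ENNReal.ofReal (g (t - (x + y))) ∂π ∂τ := by
    rw [← lintegral_const_mul' _ _ (by simp)]
    refine lintegral_mono fun z => ?_
    simpa only [sub_sub] using h (t - z)
  have h2 : 2⁻¹ * ENNReal.ofReal (g t) + ∫⁻ z, ENNReal.ofReal (-g (t - z)) ∂τ ≤
      ∫⁻ z, ENNReal.ofReal (g (t - z)) ∂τ := by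
    rw [ht, sub_zero]
    gcongr
  have hfin : ∫⁻ z, ENNReal.ofReal (g (t - z)) ∂τ ≠ ⊤ := hint.lintegral_lt_top.ne
  have hfin2 : ∫⁻ z, ENNReal.ofReal (-g (t - z)) ∂τ ≠ ⊤ := hint.neg.lintegral_lt_top.ne
  have h3 := ENNReal.toReal_mono hfin h2
  rw [ENNReal.toReal_add (by finiteness) hfin2, ENNReal.toReal_mul, ENNReal.toReal_ofReal'] at h3
  simp at h3
  linarith

theorem cdf_unif (a : ℝ) (ha : 0 < a) (s : ℝ) :
    cdf (unif (Set.Icc (-a) a)) s = max 0 (min 1 ((s + a) / (2 * a))) := by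
  have := unif_prob (Set.Icc (-a) a) (by simp; linarith) (by simp)
  rw [cdf_eq_real, measureReal_def, unif, Measure.smul_apply,
    Measure.restrict_apply measurableSet_Iic]
  have : Set.Iic s ∩ Set.Icc (-a) a = Set.Icc (-a) (min s a) := by
    ext x; simp; tauto
  rw [this, Real.volume_Icc, Real.volume_Icc, smul_eq_mul, ENNReal.toReal_mul, ENNReal.toReal_inv,
    ENNReal.toReal_ofReal (by linarith), ENNReal.toReal_ofReal']
  rw [show (s + a) / (2 * a) = (2 * a)⁻¹ * (s + a) by ring, show a - -a = 2 * a by ring]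
  have h2 : (2 * a)⁻¹ * (2 * a) = 1 := by field_simp
  have h3 : 0 < (2 * a)⁻¹ := by positivity
  rw [← h2, ← mul_min_of_nonneg _ _ h3.le, max_comm, ← mul_zero (2 * a)⁻¹,
    ← mul_max_of_nonneg _ _ h3.le, mul_zero]
  congr 2
  rw [sub_neg_eq_add, min_comm, ← min_add_add_right]
  congr 1; ring

/-- The triangular density. -/
noncomputable def hh (a t : ℝ) : ℝ := max 0 (2 * a - |t|) / (4 * a ^ 2)

theorem clamp_diff (u : ℝ) :
    max 0 (1 - |u|) = max 0 (min 1 (1 + u)) - max 0 (min 1 u) := by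
  rcases le_total 0 u with h | h
  · rw [abs_of_nonneg h, min_eq_left (by linarith : (1 : ℝ) ≤ 1 + u), max_eq_right zero_le_one]
    rcases le_total 1 u with h1 | h1
    · rw [min_eq_left h1, max_eq_left (by linarith), max_eq_right zero_le_one]; ring
    · rw [min_eq_right h1, max_eq_right (by linarith), max_eq_right h]
  · rw [abs_of_nonpos h, min_eq_right (by linarith : 1 + u ≤ 1), min_eq_right (by linarith : u ≤ 1),
      max_eq_left h, sub_zero, sub_neg_eq_add]

theorem hasDeriv_H (a : ℝ) (ha : 0 < a) (t : ℝ) :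
    HasDerivAt (cdf ((unif (Set.Icc (-a) a)).conv (unif (Set.Icc (-a) a)))) (hh a t) t := by
  have := unif_prob (Set.Icc (-a) a) (by simp; linarith) (by simp)
  set F : ℝ → ℝ := fun s => max 0 (min 1 ((s + a) / (2 * a))) with hF
  have hFc : Continuous F := by fun_prop
  have hH : (cdf ((unif (Set.Icc (-a) a)).conv (unif (Set.Icc (-a) a))) : ℝ → ℝ) =
      fun t => (2 * a)⁻¹ * ((∫ x in (0)..(t + a), F x) - ∫ x in (0)..(t - a), F x) := by
    ext t
    rw [cdf_conv]
    simp_rw [cdf_unif a ha]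
    rw [intervalIntegral.integral_interval_sub_left (hFc.intervalIntegrable _ _)
      (hFc.intervalIntegrable _ _)]
    have : ∫ x in (t - a)..(t + a), F x = ∫ x in (-a)..a, F (t - x) := by
      rw [intervalIntegral.integral_comp_sub_left]; simp
    rw [this, intervalIntegral.integral_of_le (by linarith), ← integral_Icc_eq_integral_Ioc]
    conv_lhs => rw [unif]
    rw [integral_smul_measure, Real.volume_Icc, ENNReal.toReal_inv,
      ENNReal.toReal_ofReal (by linarith), smul_eq_mul]
    congr 2; ring
  rw [hH]
  have d (u : ℝ) : HasDerivAt (fun u => ∫ x in (0)..u, F x) (F u) u :=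
    intervalIntegral.integral_hasDerivAt_right (hFc.intervalIntegrable _ _)
      (hFc.stronglyMeasurableAtFilter _ _) hFc.continuousAt
  have d1 := (d (t + a)).comp_add_const t a
  have d2 := (d (t - a)).comp_sub_const t a
  refine ((d1.sub d2).const_mul (2 * a)⁻¹).congr_deriv ?_
  symm
  simp only [hF, hh]
  have e1 : (t + a + a) / (2 * a) = 1 + t / (2 * a) := by field_simp; ring
  have e2 : (t - a + a) / (2 * a) = t / (2 * a) := by field_simp; ring
  have e3 : max 0 (2 * a - |t|) / (4 * a ^ 2) = (2 * a)⁻¹ * max 0 (1 - |t / (2 * a)|) := by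
    rw [abs_div, abs_of_pos (show 0 < 2 * a by linarith)]
    have : 2 * a - |t| = 2 * a * (1 - |t| / (2 * a)) := by field_simp
    rw [this, ← mul_zero (2 * a), ← mul_max_of_nonneg _ _ (by linarith)]
    field_simp
    ring
  rw [e1, e2, e3]
  congr 1
  exact clamp_diff _

theorem hh_lip (a : ℝ) (ha : 0 < a) (s t : ℝ) : |hh a s - hh a t| ≤ |s - t| / (4 * a ^ 2) := by
  have : 0 < 4 * a ^ 2 := by positivity
  rw [hh, hh, ← sub_div, abs_div, abs_of_pos this]
  refine div_le_div_of_nonneg_right ?_ this.le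
  refine (abs_max_sub_max_le_max _ _ _ _).trans ?_
  rw [sub_self, abs_zero, max_eq_right (abs_nonneg _), show 2 * a - |s| - (2 * a - |t|) = |t| - |s| by ring,
    abs_sub_comm s t]
  exact abs_abs_sub_abs_le_abs_sub _ _

theorem g_lower (M δ t H₀ h₀ C : ℝ) (μ ν κ : Measure ℝ)
    [IsProbabilityMeasure μ] [IsProbabilityMeasure ν] [IsProbabilityMeasure κ]
    (hμ : μ (Set.Icc (-M) M)ᶜ = 0) (hν : ν (Set.Icc (-M) M)ᶜ = 0)
    (hδ : δ ≤ (∫ x, x ∂μ) - ∫ x, x ∂ν) (hh₀ : 0 ≤ h₀)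
    (hC : ∀ x ∈ Set.Icc (-M) M, |cdf κ (t - x) - (H₀ - x * h₀)| ≤ C) :
    h₀ * δ - 2 * C ≤ cdf (ν.conv κ) t - cdf (μ.conv κ) t := by
  have key : ∀ θ : Measure ℝ, IsProbabilityMeasure θ → θ (Set.Icc (-M) M)ᶜ = 0 →
      |cdf (θ.conv κ) t - (H₀ - (∫ x, x ∂θ) * h₀)| ≤ C := by
    intro θ _ hθ
    have hae : ∀ᵐ x ∂θ, x ∈ Set.Icc (-M) M := hθ
    have hi : Integrable (fun x : ℝ => x) θ := by
      refine Integrable.of_bound (C := M) (by fun_prop) ?_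
      filter_upwards [hae] with x hx
      exact abs_le.2 hx
    have hi2 : Integrable (fun x => cdf κ (t - x)) θ := by
      refine Integrable.of_bound (C := 1) ?_ (Filter.Eventually.of_forall fun x => ?_)
      · exact ((monotone_cdf κ).measurable.comp
          (measurable_const.sub measurable_id)).aestronglyMeasurable
      · rw [Real.norm_eq_abs, abs_of_nonneg (cdf_nonneg _ _)]
        exact cdf_le_one _ _
    have e : cdf (θ.conv κ) t - (H₀ - (∫ x, x ∂θ) * h₀) =
        ∫ x, (cdf κ (t - x) - (H₀ - x * h₀)) ∂θ := by
      have hi3 : Integrable (fun x => H₀ - x * h₀) θ := (integrable_const _).sub (hi.mul_const _)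
      rw [integral_sub hi2 hi3,
        integral_sub (integrable_const _) (hi.mul_const _), integral_mul_const, cdf_conv]
      simp
    rw [e, ← Real.norm_eq_abs]
    refine (norm_integral_le_of_norm_le_const (C := C) ?_).trans (by simp)
    filter_upwards [hae] with x hx
    exact hC x hx
  have h1 := abs_le.1 (key μ inferInstance hμ)
  have h2 := abs_le.1 (key ν inferInstance hν)
  nlinarith [mul_le_mul_of_nonneg_left hδ hh₀]

theorem taylor (M a t x : ℝ) (hM : 0 < M) (ha : 0 < a) (hx : x ∈ Set.Icc (-M) M) :
    |cdf ((unif (Set.Icc (-a) a)).conv (unif (Set.Icc (-a) a))) (t - x) -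
      (cdf ((unif (Set.Icc (-a) a)).conv (unif (Set.Icc (-a) a))) t - x * hh a t)|
      ≤ M ^ 2 / (4 * a ^ 2) := by
  set H := cdf ((unif (Set.Icc (-a) a)).conv (unif (Set.Icc (-a) a)))
  have hd : ∀ y ∈ Set.Icc (-M) M, HasDerivWithinAt (fun y => H (t - y) + y * hh a t)
      (-hh a (t - y) + hh a t) (Set.Icc (-M) M) y := by
    intro y _
    have h1 := (hasDeriv_H a ha (t - y)).comp_const_sub t y
    have h2 := (hasDerivAt_id y).mul_const (hh a t)
    rw [one_mul] at h2
    exact (h1.add h2).hasDerivWithinAt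
  have hb : ∀ y ∈ Set.Icc (-M) M, ‖-hh a (t - y) + hh a t‖ ≤ M / (4 * a ^ 2) := by
    intro y hy
    have := hh_lip a ha t (t - y)
    rw [Real.norm_eq_abs, neg_add_eq_sub]
    refine this.trans (div_le_div_of_nonneg_right ?_ (by positivity))
    rw [sub_sub_cancel]
    exact abs_le.2 hy
  have := Convex.norm_image_sub_le_of_norm_hasDerivWithin_le hd hb (convex_Icc _ _)
    (show (0 : ℝ) ∈ Set.Icc (-M) M by constructor <;> linarith) hx
  rw [Real.norm_eq_abs, Real.norm_eq_abs] at this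
  have e : H (t - x) - (H t - x * hh a t) =
    H (t - x) + x * hh a t - (H (t - 0) + 0 * hh a t) := by rw [sub_zero]; ring
  rw [e]
  refine this.trans ?_
  rw [sub_zero]
  calc _ ≤ M / (4 * a ^ 2) * M := by gcongr; exact abs_le.2 hx
    _ = _ := by ring

theorem H_const (a u v : ℝ) (ha : 0 < a)
    (h : (2 * a ≤ u ∧ 2 * a ≤ v) ∨ (u ≤ - (2 * a) ∧ v ≤ -(2 * a))) :
    cdf ((unif (Set.Icc (-a) a)).conv (unif (Set.Icc (-a) a))) u =
      cdf ((unif (Set.Icc (-a) a)).conv (unif (Set.Icc (-a) a))) v := by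
  have hz : ∀ y, 2 * a ≤ |y| → hh a y = 0 := by
    intro y hy
    rw [hh, max_eq_left (by linarith), zero_div]
  have main : ∀ s : Set ℝ, Convex ℝ s → (∀ y ∈ s, 2 * a ≤ |y|) → u ∈ s → v ∈ s →
      cdf ((unif (Set.Icc (-a) a)).conv (unif (Set.Icc (-a) a))) u =
      cdf ((unif (Set.Icc (-a) a)).conv (unif (Set.Icc (-a) a))) v := by
    intro s hs hy hu hv
    have := Convex.norm_image_sub_le_of_norm_hasDerivWithin_le (C := 0)
      (fun y _ => (hasDeriv_H a ha y).hasDerivWithinAt)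
      (fun y h => by rw [hz y (hy y h), norm_zero]) hs hv hu
    rw [zero_mul] at this
    exact sub_eq_zero.1 (norm_le_zero_iff.1 this)
  rcases h with h | h
  · exact main (Set.Ici (2 * a)) (convex_Ici _) (fun y hy => le_trans hy (le_abs_self y)) h.1 h.2
  · refine main (Set.Iic (-(2 * a))) (convex_Iic _) (fun y hy => ?_) h.1 h.2
    have : y ≤ -(2 * a) := hy
    linarith [neg_le_abs y]

theorem pi_half (M a : ℝ) (hM : 0 < M) (ha : M < a) (I : Set ℝ)
    (hI : I = Set.Icc (-a - M) (-a + M) ∨ I = Set.Icc (a - M) (a + M)) :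
    (unif (Set.Icc (-a - M) (-a + M) ∪ Set.Icc (a - M) (a + M))) I = 2⁻¹ ∧
    IsProbabilityMeasure (unif (Set.Icc (-a - M) (-a + M) ∪ Set.Icc (a - M) (a + M))) := by
  have hv : volume (Set.Icc (-a - M) (-a + M) ∪ Set.Icc (a - M) (a + M)) =
      2 * ENNReal.ofReal (2 * M) := by
    rw [measure_union _ measurableSet_Icc, Real.volume_Icc, Real.volume_Icc, two_mul]
    · congr 2 <;> ring
    · rw [Set.disjoint_left]
      intro x h1 h2
      linarith [h1.2, h2.1]
  have hp : ENNReal.ofReal (2 * M) ≠ 0 := by simp [hM]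
  refine ⟨?_, unif_prob _ (by rw [hv]; simp [hM]) (by rw [hv]; exact ENNReal.mul_ne_top (by simp) ENNReal.ofReal_ne_top)⟩
  have hI2 : volume I = ENNReal.ofReal (2 * M) := by
    rcases hI with rfl | rfl <;> rw [Real.volume_Icc] <;> congr 1 <;> ring
  have hm : MeasurableSet I := by
    rcases hI with rfl | rfl <;> exact measurableSet_Icc
  have hs : I ∩ (Set.Icc (-a - M) (-a + M) ∪ Set.Icc (a - M) (a + M)) = I := by
    rcases hI with rfl | rfl <;> simp
  rw [unif, Measure.smul_apply, Measure.restrict_apply hm, hs, hI2, hv, smul_eq_mul,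
    ENNReal.mul_inv (Or.inl two_ne_zero) (Or.inl (by simp)), mul_assoc, ENNReal.inv_mul_cancel hp ENNReal.ofReal_ne_top, mul_one]

theorem stmt_11 (M ε a : ℝ) (hM : 0 < M) (hε : 0 < ε)
    (ha : 16 * M * ε⁻¹ + 8 * M ≤ a) :
    -- ρ is uniform on [-a, a]
    let ρ : Measure ℝ := unif (Set.Icc (-a) a)
    -- π is uniform on [-a-M, -a+M] ∪ [a-M, a+M]
    let π : Measure ℝ := unif (Set.Icc (-a - M) (-a + M) ∪ Set.Icc (a - M) (a + M))
    -- τ = Σ_k 2^{-(k+1)} π^(k)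
    let τ : Measure ℝ := Measure.sum fun k : ℕ => ((2 : ℝ≥0∞)⁻¹ ^ (k + 1)) • convPow π k
    -- η = ρ ∗ ρ ∗ τ
    let η : Measure ℝ := (ρ.conv ρ).conv τ
    ∀ μ ν : Measure ℝ, IsProbabilityMeasure μ → IsProbabilityMeasure ν →
      μ (Set.Icc (-M) M)ᶜ = 0 → ν (Set.Icc (-M) M)ᶜ = 0 →
      ε * M ≤ (∫ x, x ∂μ) - ∫ x, x ∂ν →
      StrictFSD (μ.conv η) (ν.conv η) := by
  intro ρ π τ η μ ν hμp hνp hμ hν hgap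
  have hMe : 0 < M * ε⁻¹ := by positivity
  have ha8 : 16 * (M * ε⁻¹) + 8 * M ≤ a := by linarith
  have ha0 : 0 < a := by linarith
  have hρ : IsProbabilityMeasure ρ :=
    unif_prob (Set.Icc (-a) a) (by simp; linarith) (by simp)
  have hπ : IsProbabilityMeasure π := (pi_half M a hM (by linarith) _ (Or.inl rfl)).2
  have hτ : IsProbabilityMeasure τ := tau_prob π
  set κ := ρ.conv ρ with hκ
  have hκp : IsProbabilityMeasure κ := by rw [hκ]; infer_instance
  set g : ℝ → ℝ := fun t => cdf (ν.conv κ) t - cdf (μ.conv κ) t with hg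
  set c : ℝ := M ^ 2 / (4 * a ^ 2) with hc
  have hc0 : 0 < c := by positivity
  have hh0 : ∀ t, 0 ≤ hh a t := fun t => by unfold hh; positivity
  have g1 : ∀ t, hh a t * (ε * M) - 2 * c ≤ g t := fun t =>
    g_lower M (ε * M) t _ (hh a t) c μ ν κ hμ hν hgap (hh0 t)
      (fun x hx => taylor M a t x hM ha0 hx)
  have g2 : ∀ t, 2 * a + M ≤ |t| → 0 ≤ g t := by
    intro t ht
    have := g_lower M (ε * M) t (cdf κ t) 0 0 μ ν κ hμ hν hgap le_rfl (fun x hx => by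
      rw [show cdf κ (t - x) = cdf κ t from H_const a (t - x) t ha0 ?_]
      · simp
      · rcases le_abs'.1 ht with h | h
        · right; constructor <;> linarith [hx.1, hx.2]
        · left; constructor <;> linarith [hx.1, hx.2])
    simp only [zero_mul, mul_zero, sub_zero] at this
    exact this
  -- value of `g` in the central region
  have g3 : ∀ t, |t| ≤ a + 2 * M → 8 * c ≤ g t := by
    intro t ht
    refine le_trans ?_ (g1 t)
    have h1 : (a - 2 * M) / (4 * a ^ 2) ≤ hh a t := by
      unfold hh
      refine div_le_div_of_nonneg_right (le_max_of_le_right (by linarith)) (by positivity)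
    have h2 : 16 * M ^ 2 ≤ (a - 2 * M) * (ε * M) := by
      have : 16 * (M * ε⁻¹) * (ε * M) ≤ (a - 2 * M) * (ε * M) := by
        apply mul_le_mul_of_nonneg_right _ (by positivity)
        linarith
      refine le_trans (le_of_eq ?_) this
      field_simp
    have h3 : (a - 2 * M) / (4 * a ^ 2) * (ε * M) ≤ hh a t * (ε * M) :=
      mul_le_mul_of_nonneg_right h1 (by positivity)
    have h4 : 16 * c ≤ (a - 2 * M) / (4 * a ^ 2) * (ε * M) := by
      rw [hc, div_mul_eq_mul_div, ← mul_div_assoc]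
      exact div_le_div_of_nonneg_right h2 (by positivity)
    linarith
  have gm : Measurable g :=
    (monotone_cdf _).measurable.sub (monotone_cdf _).measurable
  have gb : ∀ x, |g x| ≤ 1 := by
    intro x
    have h1 := cdf_nonneg (ν.conv κ) x
    have h2 := cdf_nonneg (μ.conv κ) x
    have h3 := cdf_le_one (ν.conv κ) x
    have h4 := cdf_le_one (μ.conv κ) x
    exact abs_le.2 ⟨by simp only [hg]; linarith, by simp only [hg]; linarith⟩
  have dom : ∀ s, ENNReal.ofReal (-g s) ≤ 2⁻¹ * ∫⁻ w, ENNReal.ofReal (g (s - w)) ∂π := by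
    intro s
    rcases le_or_gt 0 (g s) with h | h
    · rw [ENNReal.ofReal_of_nonpos (by linarith)]; exact zero_le
    have hs1 : |s| < 2 * a + M := by
      by_contra hcon
      exact absurd (g2 s (not_lt.1 hcon)) (not_le.2 h)
    have hs2 : 2 * a - 2 * (M * ε⁻¹) < |s| := by
      by_contra hcon
      have h1 : (2 * (M * ε⁻¹)) / (4 * a ^ 2) ≤ hh a s := by
        unfold hh
        refine div_le_div_of_nonneg_right (le_max_of_le_right (by linarith)) (by positivity)
      have h2 : (2 * (M * ε⁻¹)) / (4 * a ^ 2) * (ε * M) ≤ hh a s * (ε * M) :=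
        mul_le_mul_of_nonneg_right h1 (by positivity)
      have h3 : (2 * (M * ε⁻¹)) / (4 * a ^ 2) * (ε * M) = 2 * c := by
        rw [hc]; field_simp
      linarith [g1 s]
    obtain ⟨I, hI, hIs⟩ : ∃ I : Set ℝ, (I = Set.Icc (-a - M) (-a + M) ∨
        I = Set.Icc (a - M) (a + M)) ∧ ∀ w ∈ I, |s - w| ≤ a + 2 * M := by
      rcases le_total 0 s with h0 | h0
      · rw [abs_of_nonneg h0] at hs1 hs2
        refine ⟨_, Or.inr rfl, fun w hw => abs_le.2 ⟨?_, ?_⟩⟩ <;> linarith [hw.1, hw.2]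
      · rw [abs_of_nonpos h0] at hs1 hs2
        refine ⟨_, Or.inl rfl, fun w hw => abs_le.2 ⟨?_, ?_⟩⟩ <;> linarith [hw.1, hw.2]
    have hIm : MeasurableSet I := by
      rcases hI with rfl | rfl <;> exact measurableSet_Icc
    have hl : ENNReal.ofReal (8 * c) * 2⁻¹ ≤ ∫⁻ w, ENNReal.ofReal (g (s - w)) ∂π := by
      rw [← (pi_half M a hM (by linarith) I hI).1, ← setLIntegral_const]
      refine le_trans ?_ (setLIntegral_le_lintegral I _)
      exact setLIntegral_mono' hIm fun w hw => ENNReal.ofReal_le_ofReal (g3 _ (hIs w hw))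
    have hle : ENNReal.ofReal (-g s) ≤ ENNReal.ofReal (2 * c) := by
      apply ENNReal.ofReal_le_ofReal
      have := mul_nonneg (hh0 s) (show 0 ≤ ε * M by positivity)
      linarith [g1 s]
    refine hle.trans (le_trans (le_of_eq ?_) (mul_le_mul_right hl _))
    have h2 : (2⁻¹ : ℝ≥0∞) = ENNReal.ofReal 2⁻¹ := by
      rw [ENNReal.ofReal_inv_of_pos (by norm_num)]; simp
    rw [h2, ← ENNReal.ofReal_mul (by positivity), ← ENNReal.ofReal_mul (by positivity)]
    congr 1; ring
  have hcdf : ∀ (θ : Measure ℝ), IsProbabilityMeasure θ → ∀ t,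
      cdf (θ.conv η) t = ∫ z, cdf (θ.conv κ) (t - z) ∂τ := by
    intro θ _ t
    rw [← cdf_conv, Measure.conv_comm τ, Measure.conv_assoc]
  have hint : ∀ (θ : Measure ℝ), IsProbabilityMeasure θ → ∀ t,
      Integrable (fun z => cdf (θ.conv κ) (t - z)) τ := by
    intro θ _ t
    refine Integrable.of_bound (C := 1) ?_ (Filter.Eventually.of_forall fun x => ?_)
    · exact ((monotone_cdf _).measurable.comp
        (measurable_const.sub measurable_id)).aestronglyMeasurable
    · rw [Real.norm_eq_abs, abs_of_nonneg (cdf_nonneg _ _)]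
      exact cdf_le_one _ _
  have fin : ∀ t, max (g t) 0 / 2 ≤ cdf (ν.conv η) t - cdf (μ.conv η) t := by
    intro t
    rw [hcdf ν hνp, hcdf μ hμp, ← integral_sub (hint ν hνp t) (hint μ hμp t)]
    exact tau_pos π g gm 1 gb dom t
  refine ⟨fun t => ?_, fun heq => ?_⟩
  · have := fin t
    have h0 : 0 ≤ max (g t) 0 := le_max_right _ _
    linarith
  · have h1 := fin 0
    rw [heq, sub_self] at h1
    have h2 := g3 0 (by simp; linarith)
    have h3 := le_max_left (g 0) 0
    linarith
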